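/- Let d ≥ 1 and let (A_k)_{k∈ℕ} be a sequence of d×d real matrices all of whose entries are ≥ 1. Let (λ_k)_{k∈ℕ} be a sequence of vectors in ℝ^d with all entries positive, satisfying λ_k = A_kᵗ λ_{k+1} for every k (entrywise: (λ_k)_i = Σ_j (A_k)_{ji} (λ_{k+1})_j) and Σ_i (λ_0)_i = 1. Assume there exist K > 0 and ρ > 1 with ‖A_{k−1} A_{k−2} ⋯ A_0‖ ≤ K·ρ^k for all k ≥ 1, and that the sequence (‖A_k‖)_k has subexponential growth. Then for every ρ₁ with 0 < ρ₁ < 1/ρ there exists c > 0 such that (λ_k)_i ≥ c·ρ₁^k for all k ∈ ℕ and all indices i. -/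

import Mathlib

/-- The sum of the absolute values of all entries of a matrix. -/
def matNorm {d : ℕ} (A : Matrix (Fin d) (Fin d) ℝ) : ℝ :=
  ∑ i, ∑ j, |A i j|

open Matrix in
/-- Unrolling the recursion `λ_k = A_kᵗ λ_{k+1}` expresses `λ₀` through `λ_k`. -/
theorem length_zero_eq_vecMul_prod {d : ℕ} (A : ℕ → Matrix (Fin d) (Fin d) ℝ)
    (lam : ℕ → Fin d → ℝ)
    (hrec : ∀ k, ∀ i, lam k i = ∑ j, A k j i * lam (k + 1) j) (k : ℕ) :
    lam 0 = lam k ᵥ* ((List.range k).reverse.map A).prod := by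
  induction k with
  | zero => simp
  | succ k ih =>
    have h : lam k = lam (k + 1) ᵥ* A k := by
      ext i
      simp [hrec k i, vecMul, dotProduct, mul_comm]
    rw [ih, List.range_succ]
    simp [h, vecMul_vecMul]

open Matrix in
/-- The entry sum of `v ᵥ* M` is at most `matNorm M` times that of `v`, for `v ≥ 0`. -/
theorem sum_vecMul_le_matNorm_mul_sum {d : ℕ} (M : Matrix (Fin d) (Fin d) ℝ)
    (v : Fin d → ℝ) (hv : ∀ i, 0 ≤ v i) :
    ∑ i, (v ᵥ* M) i ≤ matNorm M * ∑ j, v j := by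
  simp only [vecMul, dotProduct, matNorm]
  rw [Finset.sum_comm, Finset.sum_mul]
  refine Finset.sum_le_sum fun j _ => ?_
  rw [Finset.sum_mul]
  refine Finset.sum_le_sum fun i _ => ?_
  have hvj : v j ≤ ∑ l, v l := Finset.single_le_sum (fun l _ => hv l) (Finset.mem_univ j)
  rw [mul_comm]
  exact mul_le_mul (le_abs_self _) hvj (hv j) (abs_nonneg _)

/-- Exponential lower bound on the lengths of inducing intervals: if positive
length vectors satisfy `λ_k = A_kᵗ λ_{k+1}` for matrices `A_k` with all entries
`≥ 1`, `‖λ₀‖₁ = 1`, the products `A_{k-1}⋯A₀` grow at most like `K·ρ^k`, and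
`(‖A_k‖)_k` grows subexponentially, then for every `0 < ρ₁ < 1/ρ` there is
`c > 0` with `(λ_k)_i ≥ c·ρ₁^k` for all `k` and `i`. -/
theorem lengths_exponential_lower_bound
    (d : ℕ) (hd : 1 ≤ d)
    (A : ℕ → Matrix (Fin d) (Fin d) ℝ)
    (hA : ∀ k, ∀ i j, 1 ≤ A k i j)
    (lam : ℕ → Fin d → ℝ)
    (hpos : ∀ k i, 0 < lam k i)
    (hrec : ∀ k, ∀ i, lam k i = ∑ j, A k j i * lam (k + 1) j)
    (hnorm : ∑ i, lam 0 i = 1)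
    (K ρ : ℝ) (hK : 0 < K) (hρ : 1 < ρ)
    (hprod : ∀ k : ℕ, 1 ≤ k →
      matNorm (((List.range k).reverse.map A).prod) ≤ K * ρ ^ k)
    (hsub : ∀ ε > (0 : ℝ), ∃ C > (0 : ℝ), ∀ k : ℕ,
      matNorm (A k) ≤ C * Real.exp (ε * k)) :
    ∀ ρ₁ : ℝ, 0 < ρ₁ → ρ₁ < 1 / ρ →
      ∃ c > (0 : ℝ), ∀ k : ℕ, ∀ i, c * ρ₁ ^ k ≤ lam k i := by
  intro ρ₁ hρ₁ hlt
  have hρ0 : 0 < ρ := by linarith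
  refine ⟨1 / (K * ρ), by positivity, fun k i => ?_⟩
  have hS0 : 0 ≤ ∑ j, lam (k + 1) j := Finset.sum_nonneg fun j _ => (hpos _ j).le
  have hS : 1 ≤ K * ρ ^ (k + 1) * ∑ j, lam (k + 1) j := by
    calc (1 : ℝ) = ∑ i, lam 0 i := hnorm.symm
      _ ≤ _ := by
        rw [length_zero_eq_vecMul_prod A lam hrec (k + 1)]
        exact sum_vecMul_le_matNorm_mul_sum _ _ fun j => (hpos _ j).le
      _ ≤ _ := mul_le_mul_of_nonneg_right (hprod (k + 1) (by omega)) hS0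
  have hle : ∑ j, lam (k + 1) j ≤ lam k i := by
    rw [hrec k i]
    exact Finset.sum_le_sum fun j _ => le_mul_of_one_le_left (hpos _ j).le (hA k j i)
  calc 1 / (K * ρ) * ρ₁ ^ k ≤ 1 / (K * ρ) * (1 / ρ) ^ k := by gcongr
    _ = 1 / (K * ρ ^ (k + 1)) := by rw [one_div_pow, pow_succ]; field_simp
    _ ≤ ∑ j, lam (k + 1) j := by
      rw [div_le_iff₀ (by positivity)]
      linarith
    _ ≤ lam k i := hle
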